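/- arXiv:1210.7436 — 2 statements merged into one kernel-verified Lean document; each statement's English description precedes it below -/
import Mathlib

section
/- If T is a compact bounded linear operator on ℓ²(ℕ, ℂ) that commutes with S + S*, i.e., T ∘ (S + S*) = (S + S*) ∘ T, then T = 0. -/
theorem adj_apply_aux
    (S : lp (fun _ : ℕ => ℂ) 2 →L[ℂ] lp (fun _ : ℕ => ℂ) 2)
    (hS0 : ∀ a : lp (fun _ : ℕ => ℂ) 2, (S a : ℕ → ℂ) 0 = 0)
    (hS : ∀ (a : lp (fun _ : ℕ => ℂ) 2) (n : ℕ), (S a : ℕ → ℂ) (n + 1) = (a : ℕ → ℂ) n)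
    (a : lp (fun _ : ℕ => ℂ) 2) (n : ℕ) :
    (ContinuousLinearMap.adjoint S a : ℕ → ℂ) n = (a : ℕ → ℂ) (n + 1) := by
  have h1 : S (lp.single 2 n (1 : ℂ)) = lp.single 2 (n + 1) (1 : ℂ) := by
    ext k
    cases k with
    | zero => rw [hS0]; simp [lp.single_apply, Pi.single_apply]
    | succ k => rw [hS]; simp [lp.single_apply, Pi.single_apply]
  have h2 := ContinuousLinearMap.adjoint_inner_right S (lp.single 2 n (1 : ℂ)) a
  rw [h1, lp.inner_single_left, lp.inner_single_left] at h2
  simpa using h2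

theorem no_eig_aux
    (S : lp (fun _ : ℕ => ℂ) 2 →L[ℂ] lp (fun _ : ℕ => ℂ) 2)
    (hS0 : ∀ a : lp (fun _ : ℕ => ℂ) 2, (S a : ℕ → ℂ) 0 = 0)
    (hS : ∀ (a : lp (fun _ : ℕ => ℂ) 2) (n : ℕ), (S a : ℕ → ℂ) (n + 1) = (a : ℕ → ℂ) n)
    (a : lp (fun _ : ℕ => ℂ) 2) (c : ℂ)
    (h : (S + ContinuousLinearMap.adjoint S) a = c • a) : a = 0 := by
  have hn : ∀ n, (S a : ℕ → ℂ) n + (a : ℕ → ℂ) (n + 1) = c * (a : ℕ → ℂ) n := by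
    intro n
    have := congrArg (fun b : lp (fun _ : ℕ => ℂ) 2 => (b : ℕ → ℂ) n) h
    simpa [adj_apply_aux S hS0 hS] using this
  have h0 : (a : ℕ → ℂ) 1 = c * (a : ℕ → ℂ) 0 := by
    have := hn 0
    rwa [hS0, zero_add, zero_add] at this
  have hs : ∀ n, (a : ℕ → ℂ) (n + 2) = c * (a : ℕ → ℂ) (n + 1) - (a : ℕ → ℂ) n := by
    intro n
    have := hn (n + 1)
    rw [hS] at this
    linear_combination this
  generalize hf : (a : ℕ → ℂ) = f at *
  have hlim : Filter.Tendsto f Filter.atTop (nhds 0) := by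
    have hm := lp.memℓp a
    rw [hf, memℓp_gen_iff (by norm_num)] at hm
    have h3 := hm.tendsto_atTop_zero
    simp only [ENNReal.toReal_ofNat, Real.rpow_ofNat] at h3
    rw [tendsto_zero_iff_norm_tendsto_zero]
    have h4 := h3.sqrt
    simpa using h4
  have hQ : ∀ n, f (n + 1) ^ 2 - c * f n * f (n + 1) + f n ^ 2 = f 0 ^ 2 := by
    intro n
    induction n with
    | zero => rw [zero_add, h0]; ring
    | succ n ih => rw [hs, ← ih]; ring
  have hl1 := hlim.comp (Filter.tendsto_add_atTop_nat 1)
  have hQl := ((hl1.pow 2).sub ((hlim.const_mul c).mul hl1)).add (hlim.pow 2)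
  have hz : f 0 = 0 := by
    have := tendsto_nhds_unique (hQl.congr hQ) tendsto_const_nhds
    simpa using this.symm
  have hall : ∀ n, f n = 0 ∧ f (n + 1) = 0 := by
    intro n
    induction n with
    | zero => exact ⟨hz, by rw [zero_add, h0, hz, mul_zero]⟩
    | succ n ih => exact ⟨ih.2, by rw [hs, ih.1, ih.2]; ring⟩
  ext n
  rw [hf]
  simpa using (hall n).1

/-- A compact operator on `ℓ²(ℕ, ℂ)` commuting with `S + S*`, where `S` is the unilateral
shift (determined by `(S a) 0 = 0` and `(S a) (n+1) = a n`), must be zero. -/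
theorem stmt_1
    (S : lp (fun _ : ℕ => ℂ) 2 →L[ℂ] lp (fun _ : ℕ => ℂ) 2)
    (hS0 : ∀ a : lp (fun _ : ℕ => ℂ) 2, (S a : ℕ → ℂ) 0 = 0)
    (hS : ∀ (a : lp (fun _ : ℕ => ℂ) 2) (n : ℕ), (S a : ℕ → ℂ) (n + 1) = (a : ℕ → ℂ) n)
    (T : lp (fun _ : ℕ => ℂ) 2 →L[ℂ] lp (fun _ : ℕ => ℂ) 2)
    (hT : IsCompactOperator T)
    (hcomm : T.comp (S + ContinuousLinearMap.adjoint S)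
      = (S + ContinuousLinearMap.adjoint S).comp T) :
    T = 0 := by
  have hno := no_eig_aux S hS0 hS
  have hH : star (S + ContinuousLinearMap.adjoint S) = S + ContinuousLinearMap.adjoint S := by
    rw [← ContinuousLinearMap.star_eq_adjoint, star_add, star_star, add_comm]
  generalize S + ContinuousLinearMap.adjoint S = H at *
  have hc : T * H = H * T := hcomm
  have hc' : H * star T = star T * H := by
    have := congrArg star hc
    rwa [star_mul, star_mul, hH] at this
  have hA : (star T * T) * H = H * (star T * T) := by
    rw [mul_assoc, hc, ← mul_assoc, ← hc', mul_assoc]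
  have hK : IsCompactOperator (star T * T) := hT.clm_comp (star T)
  have hsym : (star T * T : lp (fun _ : ℕ => ℂ) 2 →L[ℂ] lp (fun _ : ℕ => ℂ) 2).IsSymmetric :=
    (IsSelfAdjoint.star_mul_self T).isSymmetric
  have hzero : star T * T = 0 := by
    rw [← ContinuousLinearMap.eq_zero_of_forall_hasEigenvalue_eq_zero hK hsym]
    intro μ hμ
    by_contra hne
    have hfin := ContinuousLinearMap.finite_dimensional_eigenspace hK μ hne
    set E := Module.End.eigenspace ((star T * T : lp (fun _ : ℕ => ℂ) 2 →L[ℂ] lp (fun _ : ℕ => ℂ) 2) : Module.End ℂ (lp (fun _ : ℕ => ℂ) 2)) μ with hE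
    have hmap : ∀ x ∈ E, (H : Module.End ℂ (lp (fun _ : ℕ => ℂ) 2)) x ∈ E := by
      intro x hx
      rw [hE, Module.End.mem_eigenspace_iff] at hx ⊢
      have h5 := congrArg (fun B : lp (fun _ : ℕ => ℂ) 2 →L[ℂ] lp (fun _ : ℕ => ℂ) 2 => B x) hA
      have hx' : (star T * T) x = μ • x := hx
      change (star T * T) (H x) = H ((star T * T) x) at h5
      rw [hx', map_smul] at h5
      exact h5
    have : Nontrivial E := Submodule.nontrivial_iff_ne_bot.mpr hμ
    obtain ⟨c, hc⟩ := Module.End.exists_eigenvalue (LinearMap.restrict _ hmap)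
    obtain ⟨v, hv⟩ := hc.exists_hasEigenvector
    apply hv.2
    have h6 := congrArg Subtype.val hv.apply_eq_smul
    exact Subtype.ext (hno v c h6)
  exact (CStarRing.star_mul_self_eq_zero_iff T).mp hzero
end

section
/- Let δ > 0 be a real number and let a ∈ ℓ²(ℕ × ℕ, ℂ). Suppose that for all p, q ∈ ℕ the relation δ·(a(p+1, q) + a(p−1, q)) + a(p, q) = δ·(a(p, q+1) + a(p, q−1)) + a(p, q) holds, where by convention a(p−1, q) is interpreted as 0 when p = 0 and a(p, q−1) is interpreted as 0 when q = 0. Then a = 0. -/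
/-- If `a ∈ ℓ²(ℕ × ℕ, ℂ)` satisfies the coordinatewise relation
`δ(a(p+1,q) + a(p-1,q)) + a(p,q) = δ(a(p,q+1) + a(p,q-1)) + a(p,q)` for all `p, q`
(with the convention that `a(p-1,q) = 0` when `p = 0` and `a(p,q-1) = 0` when `q = 0`),
where `δ > 0`, then `a = 0`. -/
theorem stmt_2
    (δ : ℝ) (hδ : 0 < δ)
    (a : lp (fun _ : ℕ × ℕ => ℂ) 2)
    (ha : ∀ p q : ℕ,
      (δ : ℂ) * ((a : ℕ × ℕ → ℂ) (p + 1, q)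
          + (if p = 0 then 0 else (a : ℕ × ℕ → ℂ) (p - 1, q)))
        + (a : ℕ × ℕ → ℂ) (p, q)
      = (δ : ℂ) * ((a : ℕ × ℕ → ℂ) (p, q + 1)
          + (if q = 0 then 0 else (a : ℕ × ℕ → ℂ) (p, q - 1)))
        + (a : ℕ × ℕ → ℂ) (p, q)) :
    a = 0 := by
  have hδ0 : (δ : ℂ) ≠ 0 := by exact_mod_cast hδ.ne'
  have hsum : Summable fun x => ‖(a : ℕ × ℕ → ℂ) x‖ ^ 2 := by
    have h := (lp.memℓp a).summable (by norm_num)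
    simpa using h
  obtain ⟨f, hf⟩ : ∃ f : ℕ × ℕ → ℂ, f = (a : ℕ × ℕ → ℂ) := ⟨_, rfl⟩
  rw [← hf] at hsum
  simp only [← hf] at ha
  have lim : ∀ r s : ℕ, Filter.Tendsto (fun k : ℕ => f (k + r, k + s)) Filter.atTop (nhds 0) := by
    intro r s
    have hinj : Function.Injective (fun k : ℕ => (k + r, k + s)) := by
      intro x y hxy
      simp only [Prod.mk.injEq] at hxy
      omega
    have h := (hsum.comp_injective hinj).tendsto_atTop_zero
    rw [tendsto_zero_iff_norm_tendsto_zero]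
    have h2 := h.sqrt
    simpa [Function.comp_def] using h2
  have rel : ∀ p q : ℕ, f (p + 1, q) + (if p = 0 then 0 else f (p - 1, q))
      = f (p, q + 1) + (if q = 0 then 0 else f (p, q - 1)) := fun p q =>
    mul_left_cancel₀ hδ0 (add_right_cancel (ha p q))
  have key : ∀ p q : ℕ, f (p + 1, q + 1) = f (p, q) + f (0, p + q + 2) := by
    intro p
    induction p with
    | zero =>
      intro q
      have h := rel 0 (q + 1)
      simp at h
      simp only [zero_add]
      rw [h, add_comm]
    | succ p ih =>
      intro q
      have h := rel (p + 1) (q + 1)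
      simp at h
      have h2 := ih (q + 1)
      rw [show p + 1 + q + 2 = p + (q + 1) + 2 by ring]
      linear_combination h + h2
  have row : ∀ d : ℕ, f (0, d) = 0 := by
    intro d
    have hc : ∀ p : ℕ, f (p + 1, p + (d + 1)) - f (p + 0, p + (d + 2)) = f (0, d) := by
      intro p
      induction p with
      | zero =>
        have h := key 0 d
        simp at h
        simp [h]
      | succ p ih =>
        have h1 := key (p + 1) (p + (d + 1))
        have h2 := key p (p + (d + 2))
        rw [show p + 1 + (d + 1) = p + (d + 1) + 1 by ring,
          show p + 1 + (d + 2) = p + (d + 2) + 1 by ring, add_zero, h1, h2, ← ih,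
          show p + 1 + (p + (d + 1)) = p + (p + (d + 2)) by ring, add_zero]
        ring
    have h := (lim 1 (d + 1)).sub (lim 0 (d + 2))
    simp only [hc, sub_zero] at h
    exact tendsto_nhds_unique tendsto_const_nhds h
  have all : ∀ p q : ℕ, f (p, q) = 0 := by
    intro p q
    have hc : ∀ k : ℕ, f (k + p, k + q) = f (p, q) := by
      intro k
      induction k with
      | zero => simp
      | succ k ih =>
        rw [show k + 1 + p = k + p + 1 by ring, show k + 1 + q = k + q + 1 by ring, key, row,
          ih, add_zero]
    have h := lim p q
    simp only [hc] at h
    exact tendsto_nhds_unique tendsto_const_nhds h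
  ext x
  rw [← hf]
  simpa using all x.1 x.2
end
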